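/- arXiv:1811.08493 — 11 statements merged into one kernel-verified Lean document; each statement's English description precedes it below -/
import Mathlib

section
/- Let A be a Köthe matrix satisfying condition (G1-1). Then either lim_{i→∞} a_n(i) = 0 for every n ∈ ℕ, or there exists n₀ ∈ ℕ such that for every n ∈ ℕ there is a constant C > 0 with p_n(x) ≤ C·p_{n₀}(x) for all x ∈ λ₀(A) (so that λ₀(A) is normable, its topology being generated by the single norm p_{n₀}). -/
open Filter Finset Topology

noncomputable section

/-- A Köthe matrix: entries are nonnegative, increasing in `n`, and for each column some
entry is positive.  (Index `i : ℕ` corresponds to the index `i + 1` of the paper.) -/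
def KotheMatrix (a : ℕ → ℕ → ℝ) : Prop :=
  (∀ n i, 0 ≤ a n i ∧ a n i ≤ a (n + 1) i) ∧ ∀ i, ∃ n, 0 < a n i

/-- Condition (G1-1): `0 < a_n(i+1) ≤ a_n(i)`. -/
def G11 (a : ℕ → ℕ → ℝ) : Prop :=
  ∀ n i, 0 < a n (i + 1) ∧ a n (i + 1) ≤ a n i

/-- Condition (G1-2). -/
def G12 (a : ℕ → ℕ → ℝ) : Prop :=
  ∀ n, ∃ m > n, ∃ C > 0, ∀ i, a n i ≤ C * a m i ^ 2

/-- Membership in the Köthe echelon space of order zero `λ₀(A)`. -/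
def inLambda0 (a : ℕ → ℕ → ℝ) (x : ℕ → ℂ) : Prop :=
  ∀ n, Tendsto (fun i => a n i * ‖x i‖) atTop (𝓝 0)

/-- The canonical seminorms `p_n(x) = sup_i a_n(i) |x_i|` of `λ₀(A)`. -/
def pnorm (a : ℕ → ℕ → ℝ) (n : ℕ) (x : ℕ → ℂ) : ℝ :=
  ⨆ i, a n i * ‖x i‖

/-- The discrete Cesàro operator, `(C x)_i = (x_1 + ⋯ + x_i) / i` (indices shifted by one). -/
def cesaro (x : ℕ → ℂ) : ℕ → ℂ :=
  fun i => (∑ j ∈ Finset.range (i + 1), x j) / ((i : ℂ) + 1)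

/-- If `A` is a Köthe matrix satisfying (G1-1), then either all rows tend to zero, or some
seminorm `p_{n₀}` dominates all the others (so `λ₀(A)` is normable). -/
theorem stmt0 (a : ℕ → ℕ → ℝ) (hK : KotheMatrix a) (hG : G11 a) :
    (∀ n, Tendsto (fun i => a n i) atTop (𝓝 0)) ∨
      ∃ n₀ : ℕ, ∀ n : ℕ, ∃ C > (0 : ℝ),
        ∀ x : ℕ → ℂ, inLambda0 a x → pnorm a n x ≤ C * pnorm a n₀ x := by
  by_contra! h
  obtain ⟨⟨n₀, hn₀⟩, h⟩ := h
  obtain ⟨n, hn⟩ := h n₀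
  have hanti : ∀ m, Antitone (a m) := fun m => antitone_nat_of_succ_le fun i => (hG m i).2
  have hbdd : BddBelow (Set.range (a n₀)) := ⟨0, by rintro _ ⟨i, rfl⟩; exact (hK.1 n₀ i).1⟩
  have hlim := tendsto_atTop_ciInf (hanti n₀) hbdd
  have hc : 0 < ⨅ i, a n₀ i := by
    refine lt_of_le_of_ne (le_ciInf fun i => (hK.1 n₀ i).1) fun h0 => hn₀ ?_
    rwa [← h0] at hlim
  set c := ⨅ i, a n₀ i
  have hM : 0 < a n 0 := (hG n 0).1.trans_le (hG n 0).2
  obtain ⟨x, hx, hlt⟩ := hn (a n 0 / c) (div_pos hM hc)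
  refine hlt.not_ge (ciSup_le fun i => ?_)
  calc a n i * ‖x i‖ ≤ a n 0 * ‖x i‖ := by gcongr; exact hanti n (Nat.zero_le i)
    _ = a n 0 / c * (c * ‖x i‖) := by field_simp
    _ ≤ a n 0 / c * (a n₀ i * ‖x i‖) := by gcongr; exact ciInf_le hbdd i
    _ ≤ a n 0 / c * pnorm a n₀ x := by
      gcongr
      exact le_ciSup (hx n₀).bddAbove_range i
end
end

section
/- Let A be a Köthe matrix with a_n(i) > 0 for all n, i. Then the following are equivalent: (1) the Cesàro operator C maps λ₀(A) into itself and for every n there exist m and M > 0 with p_n(C x) ≤ M·p_m(x) for all x ∈ λ₀(A) (i.e. C : λ₀(A) → λ₀(A) is continuous); (2) for every n there exists m such that sup_{i} (a_n(i)/i)·Σ_{j=1}^{i} 1/a_m(j) < ∞. -/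
open Filter Finset Topology

noncomputable section

theorem inLambda0.bddAbove {a : ℕ → ℕ → ℝ} {x : ℕ → ℂ} (hx : inLambda0 a x) (n : ℕ) :
    BddAbove (Set.range fun i => a n i * ‖x i‖) :=
  (hx n).bddAbove_range

theorem norm_cesaro_le (x : ℕ → ℂ) (i : ℕ) :
    ‖cesaro x i‖ ≤ (∑ j ∈ Finset.range (i + 1), ‖x j‖) / ((i : ℝ) + 1) := by
  have h : ‖(i : ℂ) + 1‖ = (i : ℝ) + 1 := by
    exact_mod_cast Complex.norm_natCast (i + 1)
  rw [cesaro, norm_div, h]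
  gcongr
  exact norm_sum_le _ _

theorem tendsto_sum_range_one_div_atTop {w : ℕ → ℝ} (hw : ∀ i, 0 < w i) {K : ℝ}
    (hK : ∀ i, w i / ((i : ℝ) + 1) ≤ K) :
    Tendsto (fun i => ∑ j ∈ Finset.range i, 1 / w j) atTop atTop := by
  have hK0 : 0 < K := lt_of_lt_of_le (div_pos (hw 0) (by positivity)) (hK 0)
  refine tendsto_atTop_mono (fun i => ?_)
    (Real.tendsto_sum_range_one_div_nat_succ_atTop.const_mul_atTop (inv_pos.2 hK0))
  rw [Finset.mul_sum]
  refine Finset.sum_le_sum fun j _ => ?_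
  have hj : (0 : ℝ) < (j : ℝ) + 1 := by positivity
  have h := (div_le_iff₀ hj).1 (hK j)
  calc K⁻¹ * (1 / ((j : ℝ) + 1)) = 1 / (K * ((j : ℝ) + 1)) := by field_simp
    _ ≤ 1 / w j := one_div_le_one_div_of_le (hw j) h

/-- The summability condition bounds `w i / (i + 1)`, keeping only the first summand. -/
theorem div_succ_le_of_mul_sum_le {w v : ℕ → ℝ} (hw : ∀ i, 0 < w i) (hv : ∀ i, 0 < v i) {M : ℝ}
    (h : ∀ i : ℕ, w i / ((i : ℝ) + 1) * (∑ j ∈ Finset.range (i + 1), 1 / v j) ≤ M) (i : ℕ) :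
    w i / ((i : ℝ) + 1) ≤ M * v 0 := by
  have h1 : 1 / v 0 ≤ ∑ j ∈ Finset.range (i + 1), 1 / v j :=
    Finset.single_le_sum (f := fun j => 1 / v j) (fun j _ => (one_div_pos.2 (hv j)).le) (by simp)
  have h2 : 0 ≤ w i / ((i : ℝ) + 1) := div_nonneg (hw i).le (by positivity)
  rw [← div_le_iff₀ (hv 0), div_eq_mul_one_div]
  exact (mul_le_mul_of_nonneg_left h1 h2).trans (h i)

theorem tendsto_mul_norm_cesaro {w v : ℕ → ℝ} (hw : ∀ i, 0 < w i) (hv : ∀ i, 0 < v i) {M : ℝ}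
    (h : ∀ i : ℕ, w i / ((i : ℝ) + 1) * (∑ j ∈ Finset.range (i + 1), 1 / v j) ≤ M)
    (hdiv : Tendsto (fun i => ∑ j ∈ Finset.range i, 1 / v j) atTop atTop) {x : ℕ → ℂ}
    (hx : Tendsto (fun i => v i * ‖x i‖) atTop (𝓝 0)) :
    Tendsto (fun i => w i * ‖cesaro x i‖) atTop (𝓝 0) := by
  have hlit : (fun i => ‖x i‖) =o[atTop] fun i => 1 / v i := by
    rw [Asymptotics.isLittleO_iff_tendsto fun i hi => absurd hi (one_div_pos.2 (hv i)).ne']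
    refine hx.congr fun i => ?_
    rw [div_div_eq_mul_div, div_one, mul_comm]
  have hsum := (hlit.sum_range (fun i => (one_div_pos.2 (hv i)).le) hdiv).comp_tendsto
    (tendsto_add_atTop_nat 1)
  have hprod := (Asymptotics.isBigO_refl (fun i : ℕ => w i / ((i : ℝ) + 1)) atTop).mul_isLittleO
    hsum
  have hbdd : (fun i : ℕ => w i / ((i : ℝ) + 1) * (∑ j ∈ Finset.range (i + 1), 1 / v j))
      =O[atTop] fun _ => (1 : ℝ) := by
    refine Asymptotics.IsBigO.of_bound M (Eventually.of_forall fun i => ?_)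
    have h0 : 0 ≤ w i / ((i : ℝ) + 1) * (∑ j ∈ Finset.range (i + 1), 1 / v j) :=
      mul_nonneg (div_nonneg (hw i).le (by positivity))
        (Finset.sum_nonneg fun j _ => (one_div_pos.2 (hv j)).le)
    rw [Real.norm_of_nonneg h0, norm_one, mul_one]
    exact h i
  have hlim := (Asymptotics.isLittleO_one_iff ℝ).1 (hprod.trans_isBigO hbdd)
  refine squeeze_zero (fun i => mul_nonneg (hw i).le (norm_nonneg _)) (fun i => ?_) hlim
  calc w i * ‖cesaro x i‖ ≤ w i * ((∑ j ∈ Finset.range (i + 1), ‖x j‖) / ((i : ℝ) + 1)) :=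
        mul_le_mul_of_nonneg_left (norm_cesaro_le x i) (hw i).le
    _ = w i / ((i : ℝ) + 1) * ∑ j ∈ Finset.range (i + 1), ‖x j‖ := by ring

theorem pnorm_cesaro_le {a : ℕ → ℕ → ℝ} (hpos : ∀ n i, 0 < a n i) {n m : ℕ} {M : ℝ}
    (h : ∀ i : ℕ, a n i / ((i : ℝ) + 1) * (∑ j ∈ Finset.range (i + 1), 1 / a m j) ≤ M)
    {x : ℕ → ℂ} (hx : inLambda0 a x) : pnorm a n (cesaro x) ≤ M * pnorm a m x := by
  have hp : 0 ≤ pnorm a m x :=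
    Real.iSup_nonneg fun i => mul_nonneg (hpos m i).le (norm_nonneg _)
  have hle : ∀ j, ‖x j‖ ≤ 1 / a m j * pnorm a m x := fun j => by
    rw [one_div_mul_eq_div, le_div_iff₀ (hpos m j), mul_comm]
    exact le_ciSup (hx.bddAbove m) j
  refine ciSup_le fun i => ?_
  have hi := (hpos n i).le
  calc a n i * ‖cesaro x i‖
      ≤ a n i * ((∑ j ∈ Finset.range (i + 1), ‖x j‖) / ((i : ℝ) + 1)) :=
        mul_le_mul_of_nonneg_left (norm_cesaro_le x i) hi
    _ ≤ a n i * ((∑ j ∈ Finset.range (i + 1), 1 / a m j * pnorm a m x) / ((i : ℝ) + 1)) := by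
        gcongr with j _
        exact hle j
    _ = a n i / ((i : ℝ) + 1) * (∑ j ∈ Finset.range (i + 1), 1 / a m j) * pnorm a m x := by
        rw [← Finset.sum_mul]
        ring
    _ ≤ M * pnorm a m x := mul_le_mul_of_nonneg_right (h i) hp

/-- Testing a seminorm estimate on the truncations of `1 / a m`. -/
theorem mul_sum_one_div_le_of_pnorm_cesaro_le {a : ℕ → ℕ → ℝ} (hpos : ∀ n i, 0 < a n i)
    (hC : ∀ x : ℕ → ℂ, inLambda0 a x → inLambda0 a (cesaro x)) {n m : ℕ} {M : ℝ} (hM : 0 ≤ M)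
    (h : ∀ x : ℕ → ℂ, inLambda0 a x → pnorm a n (cesaro x) ≤ M * pnorm a m x) (i : ℕ) :
    a n i / ((i : ℝ) + 1) * (∑ j ∈ Finset.range (i + 1), 1 / a m j) ≤ M := by
  set x : ℕ → ℂ := fun j => if j < i + 1 then ((1 / a m j : ℝ) : ℂ) else 0 with hxdef
  have hx : inLambda0 a x := fun k => by
    refine tendsto_const_nhds.congr' ?_
    filter_upwards [eventually_ge_atTop (i + 1)] with j hj
    simp only [hxdef, if_neg (not_lt.2 hj), norm_zero, mul_zero]
  have hpx : pnorm a m x ≤ 1 := ciSup_le fun j => by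
    have hj := hpos m j
    by_cases hji : j < i + 1
    · simp only [hxdef, if_pos hji]
      rw [Complex.norm_of_nonneg (one_div_pos.2 hj).le, mul_one_div_cancel hj.ne']
    · simp only [hxdef, if_neg hji, norm_zero, mul_zero, zero_le_one]
  have hsum : cesaro x i =
      (((∑ j ∈ Finset.range (i + 1), 1 / a m j) / ((i : ℝ) + 1) : ℝ) : ℂ) := by
    rw [cesaro, Complex.ofReal_div, Complex.ofReal_sum]
    push_cast
    congr 1
    refine Finset.sum_congr rfl fun j hj => ?_
    simp only [hxdef, if_pos (Finset.mem_range.1 hj), Complex.ofReal_div, Complex.ofReal_one]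
  have hnn : 0 ≤ (∑ j ∈ Finset.range (i + 1), 1 / a m j) / ((i : ℝ) + 1) :=
    div_nonneg (Finset.sum_nonneg fun j _ => (one_div_pos.2 (hpos m j)).le) (by positivity)
  calc a n i / ((i : ℝ) + 1) * (∑ j ∈ Finset.range (i + 1), 1 / a m j)
      = a n i * ‖cesaro x i‖ := by
        rw [hsum, Complex.norm_of_nonneg hnn]
        ring
    _ ≤ pnorm a n (cesaro x) := le_ciSup ((hC x hx).bddAbove n) i
    _ ≤ M * pnorm a m x := h x hx
    _ ≤ M := mul_le_of_le_one_right hM hpx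

/-- Continuity of the Cesàro operator on `λ₀(A)` is equivalent to the boundedness condition
on the matrix `A`. -/
theorem stmt1 (a : ℕ → ℕ → ℝ) (hK : KotheMatrix a) (hpos : ∀ n i, 0 < a n i) :
    ((∀ x : ℕ → ℂ, inLambda0 a x → inLambda0 a (cesaro x)) ∧
        ∀ n : ℕ, ∃ m : ℕ, ∃ M > (0 : ℝ),
          ∀ x : ℕ → ℂ, inLambda0 a x → pnorm a n (cesaro x) ≤ M * pnorm a m x) ↔
      (∀ n : ℕ, ∃ m : ℕ, ∃ M : ℝ,
        ∀ i : ℕ, a n i / ((i : ℝ) + 1) * (∑ j ∈ Finset.range (i + 1), 1 / a m j) ≤ M) := by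
  constructor
  · rintro ⟨hC, hcont⟩ n
    obtain ⟨m, M, hM, h⟩ := hcont n
    exact ⟨m, M, mul_sum_one_div_le_of_pnorm_cesaro_le hpos hC hM.le h⟩
  · intro h
    refine ⟨fun x hx n => ?_, fun n => ?_⟩
    · obtain ⟨m, M, hM⟩ := h n
      obtain ⟨k, K, hK'⟩ := h m
      exact tendsto_mul_norm_cesaro (hpos n) (hpos m) hM
        (tendsto_sum_range_one_div_atTop (hpos m)
          (div_succ_le_of_mul_sum_le (hpos m) (hpos k) hK')) (hx m)
    · obtain ⟨m, M, hM⟩ := h n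
      exact ⟨m, max M 1, by positivity, fun x hx =>
        pnorm_cesaro_le hpos (fun i => (hM i).trans (le_max_left _ _)) hx⟩
end
end

section
/- Let A be a Köthe matrix satisfying condition (G1-1). Then the Cesàro operator C maps λ₀(A) into itself and satisfies p_n(C x) ≤ p_n(x) for every n ∈ ℕ and every x ∈ λ₀(A); in particular C : λ₀(A) → λ₀(A) is continuous. -/
open Filter Finset Topology

noncomputable section

/-- Under (G1-1), the weighted Cesàro means are dominated by the Cesàro means of the weighted
sequence. -/
theorem mul_norm_cesaro_le {a : ℕ → ℕ → ℝ} (hG : G11 a) (n : ℕ) (x : ℕ → ℂ) (i : ℕ) :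
    a n i * ‖cesaro x i‖ ≤
      ((i + 1 : ℕ) : ℝ)⁻¹ * ∑ j ∈ Finset.range (i + 1), a n j * ‖x j‖ := by
  have hanti : Antitone (a n) := antitone_nat_of_succ_le fun i => (hG n i).2
  have h0 : 0 ≤ a n i := ((hG n i).1.trans_le (hG n i).2).le
  have hnorm : ‖(i : ℂ) + 1‖ = ((i + 1 : ℕ) : ℝ) := by
    rw [← Nat.cast_add_one, Complex.norm_natCast]
  calc a n i * ‖cesaro x i‖
      = ((i + 1 : ℕ) : ℝ)⁻¹ * (a n i * ‖∑ j ∈ Finset.range (i + 1), x j‖) := by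
        rw [cesaro, norm_div, hnorm]
        ring
    _ ≤ ((i + 1 : ℕ) : ℝ)⁻¹ * (a n i * ∑ j ∈ Finset.range (i + 1), ‖x j‖) := by
        gcongr
        exact norm_sum_le _ _
    _ ≤ ((i + 1 : ℕ) : ℝ)⁻¹ * ∑ j ∈ Finset.range (i + 1), a n j * ‖x j‖ := by
        rw [Finset.mul_sum]
        gcongr with j hj
        exact hanti (Nat.lt_succ_iff.mp (Finset.mem_range.mp hj))

/-- If `A` satisfies (G1-1), the Cesàro operator maps `λ₀(A)` into itself with
`p_n(C x) ≤ p_n(x)` for every `n`; in particular it is continuous. -/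
theorem stmt2 (a : ℕ → ℕ → ℝ) (hK : KotheMatrix a) (hG : G11 a) :
    ∀ x : ℕ → ℂ, inLambda0 a x →
      inLambda0 a (cesaro x) ∧ ∀ n : ℕ, pnorm a n (cesaro x) ≤ pnorm a n x := by
  intro x hx
  refine ⟨fun n => ?_, fun n => ciSup_le fun i => ?_⟩
  · exact squeeze_zero (fun i => mul_nonneg (hK.1 n i).1 (norm_nonneg _))
      (mul_norm_cesaro_le hG n x) ((tendsto_add_atTop_iff_nat 1).2 (hx n).cesaro)
  · have hle (j : ℕ) : a n j * ‖x j‖ ≤ pnorm a n x := le_ciSup (hx n).bddAbove_range j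
    calc a n i * ‖cesaro x i‖
        ≤ ((i + 1 : ℕ) : ℝ)⁻¹ * ∑ j ∈ Finset.range (i + 1), a n j * ‖x j‖ :=
          mul_norm_cesaro_le hG n x i
      _ ≤ ((i + 1 : ℕ) : ℝ)⁻¹ * ∑ _j ∈ Finset.range (i + 1), pnorm a n x := by
          gcongr with j
          exact hle j
      _ = pnorm a n x := by
          rw [Finset.sum_const, Finset.card_range, nsmul_eq_mul,
            inv_mul_cancel_left₀ (Nat.cast_ne_zero.mpr i.succ_ne_zero)]
end
end

section
/- Let A be a Köthe matrix satisfying condition (G1-1), and let D : ℂ^ℕ → ℂ^ℕ be the formal differentiation operator (D x)_i = i·x_{i+1}. Then the following are equivalent: (1) D maps λ₀(A) into itself and for every n there exist m and M > 0 with p_n(D x) ≤ M·p_m(x) for all x ∈ λ₀(A) (i.e. D : λ₀(A) → λ₀(A) is continuous); (2) for every n there exist m > n and M > 0 such that i·a_n(i) ≤ M·a_m(i+1) for all i ∈ ℕ. -/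
open Filter Finset Topology

noncomputable section

/-- The formal differentiation operator `(D x)_i = i · x_{i+1}` (indices shifted by one). -/
def Dop (x : ℕ → ℂ) : ℕ → ℂ := fun i => ((i : ℂ) + 1) * x (i + 1)

lemma KotheMatrix.monotone {a : ℕ → ℕ → ℝ} (hK : KotheMatrix a) (i : ℕ) :
    Monotone fun n => a n i :=
  monotone_nat_of_le_succ fun n => (hK.1 n i).2

lemma inLambda0.le_pnorm {a : ℕ → ℕ → ℝ} {x : ℕ → ℂ} (hx : inLambda0 a x) (n i : ℕ) :
    a n i * ‖x i‖ ≤ pnorm a n x :=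
  le_ciSup (f := fun i => a n i * ‖x i‖) (hx n).bddAbove_range i

lemma inLambda0_single (a : ℕ → ℕ → ℝ) (j : ℕ) : inLambda0 a (Pi.single j 1) := by
  intro n
  refine tendsto_const_nhds.congr' ?_
  filter_upwards [eventually_gt_atTop j] with i hi
  simp [Pi.single_eq_of_ne hi.ne']

lemma pnorm_single_le {a : ℕ → ℕ → ℝ} (hK : KotheMatrix a) (n j : ℕ) :
    pnorm a n (Pi.single j 1) ≤ a n j := by
  refine ciSup_le fun i => ?_
  obtain rfl | h := eq_or_ne i j
  · simp
  · simpa [Pi.single_eq_of_ne h] using (hK.1 n j).1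

lemma norm_Dop (x : ℕ → ℂ) (i : ℕ) : ‖Dop x i‖ = ((i : ℝ) + 1) * ‖x (i + 1)‖ := by
  have h : ‖(i : ℂ) + 1‖ = (i : ℝ) + 1 := by
    exact_mod_cast Complex.norm_natCast (i + 1)
  rw [Dop, norm_mul, h]

lemma mul_norm_Dop_le {a : ℕ → ℕ → ℝ} {n m : ℕ} {M : ℝ}
    (h : ∀ i : ℕ, ((i : ℝ) + 1) * a n i ≤ M * a m (i + 1)) (x : ℕ → ℂ) (i : ℕ) :
    a n i * ‖Dop x i‖ ≤ M * (a m (i + 1) * ‖x (i + 1)‖) := by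
  calc a n i * ‖Dop x i‖ = ((i : ℝ) + 1) * a n i * ‖x (i + 1)‖ := by rw [norm_Dop]; ring
    _ ≤ M * a m (i + 1) * ‖x (i + 1)‖ :=
      mul_le_mul_of_nonneg_right (h i) (norm_nonneg _)
    _ = M * (a m (i + 1) * ‖x (i + 1)‖) := mul_assoc _ _ _

/-- Continuity of the differentiation operator `D` on `λ₀(A)` is equivalent to the matrix
condition `i·a_n(i) ≤ M·a_m(i+1)`. -/
theorem stmt3 (a : ℕ → ℕ → ℝ) (hK : KotheMatrix a) (hG : G11 a) :
    ((∀ x : ℕ → ℂ, inLambda0 a x → inLambda0 a (Dop x)) ∧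
        ∀ n : ℕ, ∃ m : ℕ, ∃ M > (0 : ℝ),
          ∀ x : ℕ → ℂ, inLambda0 a x → pnorm a n (Dop x) ≤ M * pnorm a m x) ↔
      (∀ n : ℕ, ∃ m > n, ∃ M > (0 : ℝ),
        ∀ i : ℕ, ((i : ℝ) + 1) * a n i ≤ M * a m (i + 1)) := by
  constructor
  · rintro ⟨hD, hbound⟩ n
    obtain ⟨m, M, hM, h⟩ := hbound n
    refine ⟨max m (n + 1), by omega, M, hM, fun i => ?_⟩
    have hx := inLambda0_single a (i + 1)
    calc ((i : ℝ) + 1) * a n i = a n i * ‖Dop (Pi.single (i + 1) 1) i‖ := by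
          rw [norm_Dop]; simp [mul_comm]
      _ ≤ pnorm a n (Dop (Pi.single (i + 1) 1)) := (hD _ hx).le_pnorm n i
      _ ≤ M * pnorm a m (Pi.single (i + 1) 1) := h _ hx
      _ ≤ M * a (max m (n + 1)) (i + 1) := by
          gcongr
          exact (pnorm_single_le hK m (i + 1)).trans (hK.monotone (i + 1) (le_max_left _ _))
  · refine fun h => ⟨fun x hx n => ?_, fun n => ?_⟩
    · obtain ⟨m, -, M, -, hM⟩ := h n
      refine squeeze_zero (fun i => mul_nonneg (hK.1 n i).1 (norm_nonneg _))
        (mul_norm_Dop_le hM x) ?_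
      simpa using ((tendsto_add_atTop_iff_nat 1).2 (hx m)).const_mul M
    · obtain ⟨m, -, M, hM0, hM⟩ := h n
      refine ⟨m, M, hM0, fun x hx => ciSup_le fun i => (mul_norm_Dop_le hM x i).trans ?_⟩
      gcongr
      exact hx.le_pnorm m (i + 1)
end
end

section
/- Let A be a G₁-matrix. Then the following are equivalent: (1) for every n there exists m > n with Σ_{i=1}^∞ a_n(i)/a_m(i) < ∞ (the Grothendieck–Pietsch condition, i.e. λ₀(A) is nuclear); (2) for every n there exists m > n with sup_i i·a_n(i)/a_m(i) < ∞; (3) for every α ∈ ℝ and every n there exists m > n with sup_i i^α·a_n(i)/a_m(i) < ∞. -/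
open Filter Finset Topology

noncomputable section

theorem G11.pos {a : ℕ → ℕ → ℝ} (h : G11 a) (n i : ℕ) : 0 < a n i := by
  cases i with
  | zero => exact (h n 0).1.trans_le (h n 0).2
  | succ i => exact (h n i).1

theorem G11.antitone {a : ℕ → ℕ → ℝ} (h : G11 a) (n : ℕ) : Antitone (a n) :=
  antitone_nat_of_succ_le fun i => (h n i).2

/-- The terms of an antitone summable nonnegative sequence are `O(1 / (i + 1))`. -/
theorem succ_mul_le_tsum_of_antitone {f : ℕ → ℝ} (hf : Antitone f) (h0 : ∀ i, 0 ≤ f i)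
    (hs : Summable f) (i : ℕ) : ((i : ℝ) + 1) * f i ≤ ∑' j, f j := by
  calc ((i : ℝ) + 1) * f i = ∑ _j ∈ range (i + 1), f i := by simp
    _ ≤ ∑ j ∈ range (i + 1), f j :=
      sum_le_sum fun j hj => hf (Nat.le_of_lt_succ (mem_range.1 hj))
    _ ≤ ∑' j, f j := hs.sum_le_tsum _ fun j _ => h0 j

theorem exists_succ_mul_le_of_summable {a : ℕ → ℕ → ℝ} (hG1 : G11 a) (hG2 : G12 a)
    (h : ∀ n : ℕ, ∃ m > n, Summable (fun i => a n i / a m i)) (n : ℕ) :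
    ∃ m > n, ∃ M : ℝ, ∀ i : ℕ, ((i : ℝ) + 1) * a n i / a m i ≤ M := by
  obtain ⟨m, hm, C, hC, hle⟩ := hG2 n
  obtain ⟨k, -, hs⟩ := h m
  have hsum : Summable (a m) := by
    refine Summable.of_nonneg_of_le (fun i => (hG1.pos m i).le) (fun i => ?_)
      (hs.mul_left (a k 0))
    have hk := hG1.pos k i
    rw [← mul_div_assoc, le_div_iff₀ hk, mul_comm]
    exact mul_le_mul_of_nonneg_right (hG1.antitone k (Nat.zero_le i)) (hG1.pos m i).le
  refine ⟨m, hm, C * ∑' j, a m j, fun i => ?_⟩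
  have hp := hG1.pos m i
  have hi := succ_mul_le_tsum_of_antitone (hG1.antitone m) (fun i => (hG1.pos m i).le) hsum i
  rw [div_le_iff₀ hp]
  calc ((i : ℝ) + 1) * a n i ≤ ((i : ℝ) + 1) * (C * a m i ^ 2) :=
        mul_le_mul_of_nonneg_left (hle i) (by positivity)
    _ = C * (((i : ℝ) + 1) * a m i) * a m i := by ring
    _ ≤ C * (∑' j, a m j) * a m i := by gcongr

theorem exists_succ_pow_mul_le {a : ℕ → ℕ → ℝ} (hK : KotheMatrix a) (hG1 : G11 a)
    (h : ∀ n : ℕ, ∃ m > n, ∃ M : ℝ, ∀ i : ℕ, ((i : ℝ) + 1) * a n i / a m i ≤ M) (k n : ℕ) :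
    ∃ m > n, ∃ M : ℝ, ∀ i : ℕ, ((i : ℝ) + 1) ^ k * a n i / a m i ≤ M := by
  induction k with
  | zero =>
    refine ⟨n + 1, n.lt_succ_self, 1, fun i => ?_⟩
    rw [pow_zero, one_mul]
    exact div_le_one_of_le₀ (hK.1 n i).2 (hK.1 (n + 1) i).1
  | succ k ih =>
    obtain ⟨m, hm, M, hM⟩ := ih
    obtain ⟨l, hl, N, hN⟩ := h m
    refine ⟨l, hm.trans hl, M * N, fun i => ?_⟩
    have hn := hG1.pos n i
    have hp := hG1.pos m i
    have hq := hG1.pos l i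
    have h1 : 0 ≤ ((i : ℝ) + 1) ^ k * a n i / a m i := by positivity
    calc ((i : ℝ) + 1) ^ (k + 1) * a n i / a l i
        = (((i : ℝ) + 1) ^ k * a n i / a m i) * (((i : ℝ) + 1) * a m i / a l i) := by
          field_simp
          ring
      _ ≤ M * N := mul_le_mul (hM i) (hN i) (by positivity) (h1.trans (hM i))

theorem exists_succ_rpow_mul_le {a : ℕ → ℕ → ℝ} (hK : KotheMatrix a) (hG1 : G11 a)
    (h : ∀ n : ℕ, ∃ m > n, ∃ M : ℝ, ∀ i : ℕ, ((i : ℝ) + 1) * a n i / a m i ≤ M)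
    (α : ℝ) (n : ℕ) :
    ∃ m > n, ∃ M : ℝ, ∀ i : ℕ, ((i : ℝ) + 1) ^ α * a n i / a m i ≤ M := by
  obtain ⟨k, hk⟩ := exists_nat_ge α
  obtain ⟨m, hm, M, hM⟩ := exists_succ_pow_mul_le hK hG1 h k n
  refine ⟨m, hm, M, fun i => le_trans ?_ (hM i)⟩
  have hn := hG1.pos n i
  have hp := hG1.pos m i
  have hle : ((i : ℝ) + 1) ^ α ≤ ((i : ℝ) + 1) ^ k := by
    rw [← Real.rpow_natCast]
    exact Real.rpow_le_rpow_of_exponent_le (by simp) hk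
  gcongr

theorem exists_summable_of_succ_mul_le {a : ℕ → ℕ → ℝ} (hK : KotheMatrix a) (hG1 : G11 a)
    (h : ∀ n : ℕ, ∃ m > n, ∃ M : ℝ, ∀ i : ℕ, ((i : ℝ) + 1) * a n i / a m i ≤ M) (n : ℕ) :
    ∃ m > n, Summable (fun i => a n i / a m i) := by
  obtain ⟨m, hm, M, hM⟩ := exists_succ_pow_mul_le hK hG1 h 2 n
  have hs : Summable fun i : ℕ => 1 / ((i : ℝ) + 1) ^ 2 := by
    simpa using (summable_nat_add_iff 1).2 (Real.summable_one_div_nat_pow.2 one_lt_two)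
  refine ⟨m, hm, Summable.of_nonneg_of_le
    (fun i => (div_pos (hG1.pos n i) (hG1.pos m i)).le) (fun i => ?_) (hs.mul_left M)⟩
  rw [mul_one_div, le_div_iff₀ (by positivity), mul_comm, ← mul_div_assoc]
  exact hM i

/-- For a `G₁`-matrix: the Grothendieck–Pietsch nuclearity condition is equivalent to the
polynomial-domination conditions (with exponent `1`, resp. an arbitrary real `α`). -/
theorem stmt4 (a : ℕ → ℕ → ℝ) (hK : KotheMatrix a) (hG1 : G11 a) (hG2 : G12 a) :
    ((∀ n : ℕ, ∃ m > n, Summable (fun i => a n i / a m i)) ↔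
        ∀ n : ℕ, ∃ m > n, ∃ M : ℝ, ∀ i : ℕ, ((i : ℝ) + 1) * a n i / a m i ≤ M) ∧
      ((∀ n : ℕ, ∃ m > n, ∃ M : ℝ, ∀ i : ℕ, ((i : ℝ) + 1) * a n i / a m i ≤ M) ↔
        ∀ α : ℝ, ∀ n : ℕ, ∃ m > n, ∃ M : ℝ,
          ∀ i : ℕ, ((i : ℝ) + 1) ^ α * a n i / a m i ≤ M) := by
  exact ⟨⟨exists_succ_mul_le_of_summable hG1 hG2, exists_summable_of_succ_mul_le hK hG1⟩,
    exists_succ_rpow_mul_le hK hG1, fun h => by simpa only [Real.rpow_one] using h 1⟩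
end
end

section
/- Let A be a Köthe matrix satisfying condition (G1-1) such that for every n there exist m > n and M > 0 with i·a_n(i) ≤ M·a_m(i) for all i. Then the set of eigenvalues of the Cesàro operator C on λ₀(A), i.e. the set of λ ∈ ℂ for which there exists a nonzero x ∈ λ₀(A) with C x = λ·x, equals Σ = {1/k : k ∈ ℕ, k ≥ 1}. -/
open Filter Finset Topology

noncomputable section

/-- Weights whose growth absorbs a factor `i + 1` absorb every power of `i + 1`. -/
theorem exists_pow_mul_le (a : ℕ → ℕ → ℝ)
    (h : ∀ n : ℕ, ∃ m > n, ∃ M > (0 : ℝ), ∀ i : ℕ, ((i : ℝ) + 1) * a n i ≤ M * a m i)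
    (k n : ℕ) : ∃ m, ∃ M > (0 : ℝ), ∀ i : ℕ, ((i : ℝ) + 1) ^ k * a n i ≤ M * a m i := by
  induction k generalizing n with
  | zero => exact ⟨n, 1, one_pos, fun i => by simp⟩
  | succ k ih =>
    obtain ⟨m, -, M, hM, hm⟩ := h n
    obtain ⟨p, N, hN, hp⟩ := ih m
    refine ⟨p, M * N, mul_pos hM hN, fun i => ?_⟩
    calc ((i : ℝ) + 1) ^ (k + 1) * a n i
        = ((i : ℝ) + 1) ^ k * (((i : ℝ) + 1) * a n i) := by ring
      _ ≤ ((i : ℝ) + 1) ^ k * (M * a m i) := mul_le_mul_of_nonneg_left (hm i) (by positivity)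
      _ = M * (((i : ℝ) + 1) ^ k * a m i) := by ring
      _ ≤ M * (N * a p i) := mul_le_mul_of_nonneg_left (hp i) hM.le
      _ = M * N * a p i := by ring

/-- Sequences of polynomial growth belong to `λ₀(A)`. -/
theorem inLambda0_of_norm_le_pow {a : ℕ → ℕ → ℝ} (hK : KotheMatrix a) (hG : G11 a)
    (h : ∀ n : ℕ, ∃ m > n, ∃ M > (0 : ℝ), ∀ i : ℕ, ((i : ℝ) + 1) * a n i ≤ M * a m i)
    {x : ℕ → ℂ} {k : ℕ} (hx : ∀ i, ‖x i‖ ≤ ((i : ℝ) + 1) ^ k) : inLambda0 a x := by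
  intro n
  obtain ⟨m, M, hM, hm⟩ := exists_pow_mul_le a h (k + 1) n
  have hanti : Antitone (a m) := antitone_nat_of_succ_le fun i => (hG m i).2
  have hlim : Tendsto (fun i : ℕ => M * a m 0 * (1 / ((i : ℝ) + 1))) atTop (𝓝 0) := by
    simpa using tendsto_one_div_add_atTop_nhds_zero_nat.const_mul (M * a m 0)
  refine squeeze_zero (fun i => mul_nonneg (hK.1 n i).1 (norm_nonneg _)) (fun i => ?_) hlim
  have hi : (0 : ℝ) < (i : ℝ) + 1 := by positivity
  rw [mul_one_div, le_div_iff₀ hi]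
  calc a n i * ‖x i‖ * ((i : ℝ) + 1)
      ≤ a n i * ((i : ℝ) + 1) ^ k * ((i : ℝ) + 1) := by
        gcongr
        · exact (hK.1 n i).1
        · exact hx i
    _ = ((i : ℝ) + 1) ^ (k + 1) * a n i := by ring
    _ ≤ M * a m i := hm i
    _ ≤ M * a m 0 := by gcongr; exact hanti (Nat.zero_le i)

/-- The sequence `i ↦ i.choose k` is an eigenvector of the Cesàro operator. -/
theorem cesaro_choose (k i : ℕ) :
    cesaro (fun j => (j.choose k : ℂ)) i = 1 / ((k + 1 : ℕ) : ℂ) * (i.choose k : ℂ) := by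
  have hsum : ∀ n : ℕ, ∑ j ∈ Finset.range n, j.choose k = n.choose (k + 1) := by
    intro n
    induction n with
    | zero => simp
    | succ n ih => rw [Finset.sum_range_succ, ih, Nat.choose_succ_succ, add_comm]
  have hmul : ((i : ℂ) + 1) * (i.choose k : ℂ)
      = ((i + 1).choose (k + 1) : ℂ) * ((k : ℂ) + 1) := by
    exact_mod_cast Nat.add_one_mul_choose_eq i k
  have hi : (i : ℂ) + 1 ≠ 0 := Nat.cast_add_one_ne_zero i
  have hk : (k : ℂ) + 1 ≠ 0 := Nat.cast_add_one_ne_zero k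
  simp only [cesaro, ← Nat.cast_sum, hsum]
  push_cast
  field_simp
  linear_combination -hmul

/-- Every eigenvalue of the Cesàro operator on `ℂ^ℕ` is of the form `1 / (j + 1)`. -/
theorem exists_eq_of_cesaro_eq_mul {x : ℕ → ℂ} {l : ℂ} (hx : x ≠ 0)
    (hl : ∀ i, cesaro x i = l * x i) : ∃ j : ℕ, l = 1 / ((j + 1 : ℕ) : ℂ) := by
  classical
  have hex : ∃ j, x j ≠ 0 := Function.ne_iff.mp hx
  refine ⟨Nat.find hex, ?_⟩
  have hj := Nat.find_spec hex
  have hsum : ∑ i ∈ Finset.range (Nat.find hex), x i = 0 :=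
    Finset.sum_eq_zero fun i hi => not_not.mp (Nat.find_min hex (Finset.mem_range.mp hi))
  have heq := hl (Nat.find hex)
  rw [cesaro, Finset.sum_range_succ, hsum, zero_add] at heq
  apply mul_right_cancel₀ hj
  rw [← heq]
  push_cast
  ring

/-- If `A` satisfies (G1-1) and `∀ n ∃ m > n, M > 0 : i·a_n(i) ≤ M·a_m(i)`, then the point
spectrum of the Cesàro operator on `λ₀(A)` is exactly `Σ = {1/k : k ∈ ℕ, k ≥ 1}`. -/
theorem stmt6 (a : ℕ → ℕ → ℝ) (hK : KotheMatrix a) (hG : G11 a)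
    (h : ∀ n : ℕ, ∃ m > n, ∃ M > (0 : ℝ), ∀ i : ℕ, ((i : ℝ) + 1) * a n i ≤ M * a m i) :
    {l : ℂ | ∃ x : ℕ → ℂ, inLambda0 a x ∧ x ≠ 0 ∧ ∀ i, cesaro x i = l * x i} =
      {l : ℂ | ∃ k : ℕ, 1 ≤ k ∧ l = 1 / (k : ℂ)} := by
  ext l
  constructor
  · rintro ⟨x, -, hx, hl⟩
    obtain ⟨j, hj⟩ := exists_eq_of_cesaro_eq_mul hx hl
    exact ⟨j + 1, Nat.le_add_left 1 j, hj⟩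
  · rintro ⟨k, hk, rfl⟩
    obtain ⟨k, rfl⟩ := Nat.exists_eq_add_of_le' hk
    refine ⟨fun j => (j.choose k : ℂ), inLambda0_of_norm_le_pow hK hG h (k := k) fun i => ?_,
      fun h0 => ?_, cesaro_choose k⟩
    · rw [Complex.norm_natCast]
      exact_mod_cast (Nat.choose_le_pow i k).trans (Nat.pow_le_pow_left (Nat.le_succ i) k)
    · simpa using congrFun h0 k
end
end

section
/- Let α_i = 2·log(log(i+2)) and a_n(i) = exp(−e^{α_i/n}) for n, i ∈ ℕ. Then: (a) for every s ∈ ℝ, the series Σ_i 1/(i^s·a_1(i)) = Σ_i exp(e^{α_i})/i^s diverges (so S_1(A) = ∅); and (b) there exists s ∈ ℝ (e.g. any s > 2) with Σ_i 1/(i^s·a_2(i)) = Σ_i exp(e^{α_i/2})/i^s < ∞ (so S_2(A) ≠ ∅). -/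
open Filter Finset Topology

noncomputable section

theorem log_natCast_add_three_pos (i : ℕ) : 0 < Real.log ((i : ℝ) + 3) :=
  Real.log_pos (by linarith [(Nat.cast_nonneg i : (0 : ℝ) ≤ i)])

/-- For `α_i = 2 log(log(i+2))` and `a_n(i) = exp(−e^{α_i/n})` (indices shifted by one):
(a) `Σ_i 1/(i^s a_1(i)) = ∞` for all real `s`, so `S_1(A) = ∅`;
(b) `Σ_i 1/(i^s a_2(i)) < ∞` for every `s > 2`, so `S_2(A) ≠ ∅`. -/
theorem stmt12 (αf : ℕ → ℝ) (hαf : ∀ i, αf i = 2 * Real.log (Real.log ((i : ℝ) + 3)))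
    (a : ℕ → ℕ → ℝ)
    (ha : ∀ n i, a n i = Real.exp (-Real.exp (αf i / ((n : ℝ) + 1)))) :
    (∀ s : ℝ, ¬ Summable (fun i : ℕ => 1 / (((i : ℝ) + 1) ^ s * a 0 i))) ∧
      (∀ s : ℝ, 2 < s → Summable (fun i : ℕ => 1 / (((i : ℝ) + 1) ^ s * a 1 i))) := by
  refine ⟨fun s hs => ?_, fun s hs => ?_⟩
  · have hL : Tendsto (fun i : ℕ => Real.log ((i : ℝ) + 3)) atTop atTop :=
      Real.tendsto_log_atTop.comp (tendsto_natCast_atTop_atTop.atTop_add tendsto_const_nhds)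
    have hlt := hs.tendsto_atTop_zero.eventually_lt_const one_pos
    obtain ⟨i, hi, hsL⟩ := (hlt.and (hL.eventually_ge_atTop |s|)).exists
    have hLpos := log_natCast_add_three_pos i
    have hi0 : (0 : ℝ) ≤ i := Nat.cast_nonneg i
    have hexp : Real.exp (αf i / (((0 : ℕ) : ℝ) + 1)) = Real.log ((i : ℝ) + 3) ^ 2 := by
      rw [hαf, Nat.cast_zero, zero_add, div_one, ← Real.exp_log (pow_pos hLpos 2), Real.log_pow]
      norm_num
    have hlog0 : 0 ≤ Real.log ((i : ℝ) + 1) := Real.log_nonneg (by linarith)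
    have hlog : Real.log ((i : ℝ) + 1) ≤ Real.log ((i : ℝ) + 3) :=
      Real.log_le_log (by linarith) (by linarith)
    refine absurd hi (not_lt.mpr ?_)
    rw [ha, hexp, Real.rpow_def_of_pos (by linarith), ← Real.exp_add, one_div, ← Real.exp_neg]
    refine Real.one_le_exp ?_
    have h : Real.log ((i : ℝ) + 1) * s ≤ Real.log ((i : ℝ) + 3) * Real.log ((i : ℝ) + 3) :=
      (mul_le_mul_of_nonneg_left ((le_abs_self s).trans hsL) hlog0).trans
        (mul_le_mul_of_nonneg_right hlog hLpos.le)
    nlinarith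
  · have hsum : Summable (fun i : ℕ => 3 * ((i : ℝ) + 1) ^ (1 - s)) := by
      have h := (summable_nat_add_iff 1).mpr (Real.summable_nat_rpow.mpr (by linarith : 1 - s < -1))
      simpa using h.mul_left 3
    refine Summable.of_nonneg_of_le (fun i => ?_) (fun i => ?_) hsum
    · rw [ha]
      positivity
    · have hLpos := log_natCast_add_three_pos i
      have hi0 : (0 : ℝ) ≤ i := Nat.cast_nonneg i
      have hexp : Real.exp (αf i / (((1 : ℕ) : ℝ) + 1)) = Real.log ((i : ℝ) + 3) := by
        rw [hαf, Nat.cast_one, one_add_one_eq_two, mul_div_cancel_left₀ _ two_ne_zero,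
          Real.exp_log hLpos]
      have hpow : 0 < ((i : ℝ) + 1) ^ s := Real.rpow_pos_of_pos (by linarith) s
      rw [ha, hexp, Real.exp_neg, Real.exp_log (by linarith), ← div_eq_mul_inv, one_div_div,
        Real.rpow_sub (by linarith), Real.rpow_one, ← mul_div_assoc]
      gcongr
      linarith
end
end

section
/- Let f : ℝ → ℝ be strictly increasing, let (α_i)_i be a strictly increasing sequence of positive reals with α_i → ∞, and set a_n(i) = exp(−f(α_i/n)). Fix n ∈ ℕ. Then the following are equivalent: (1) there exists s ∈ ℝ with Σ_i 1/(i^s·a_n(i)) < ∞ (i.e. S_n(A) ≠ ∅); (2) there exist t > 1 and M > 0 with exp(f(α_i/n)) ≤ M·i^t for all i; (3) sup_{i ≥ 2} f(α_i/n)/log(i) < ∞. -/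
open Filter Finset Topology

noncomputable section

theorem one_div_rpow_mul_exp_neg {x : ℝ} (hx : 0 < x) (s y : ℝ) :
    1 / (x ^ s * Real.exp (-y)) = Real.exp y * x ^ (-s) := by
  rw [Real.exp_neg, Real.rpow_neg hx.le]
  have := (Real.rpow_pos_of_pos hx s).ne'
  have := (Real.exp_pos y).ne'
  field_simp

/-- A weighted series of exponentials converges for some power weight iff the exponentials grow
at most polynomially. -/
theorem exists_summable_iff_exists_exp_le (g : ℕ → ℝ) :
    (∃ s : ℝ, Summable (fun i : ℕ => 1 / (((i : ℝ) + 1) ^ s * Real.exp (-g i)))) ↔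
      ∃ t : ℝ, 1 < t ∧ ∃ M > (0 : ℝ), ∀ i : ℕ, Real.exp (g i) ≤ M * ((i : ℝ) + 1) ^ t := by
  have hx (i : ℕ) : 0 < (i : ℝ) + 1 := by positivity
  simp only [fun i : ℕ => one_div_rpow_mul_exp_neg (hx i)]
  constructor
  · rintro ⟨s, hs⟩
    have hnonneg (i : ℕ) : 0 ≤ Real.exp (g i) * ((i : ℝ) + 1) ^ (-s) := by positivity
    refine ⟨max s 2, lt_of_lt_of_le one_lt_two (le_max_right _ _),
      (∑' i : ℕ, Real.exp (g i) * ((i : ℝ) + 1) ^ (-s)) + 1,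
      add_pos_of_nonneg_of_pos (tsum_nonneg hnonneg) one_pos, fun i => ?_⟩
    have hle := hs.le_tsum i fun j _ => hnonneg j
    calc Real.exp (g i)
        = Real.exp (g i) * ((i : ℝ) + 1) ^ (-s) * ((i : ℝ) + 1) ^ s := by
          rw [mul_assoc, ← Real.rpow_add (hx i), neg_add_cancel, Real.rpow_zero, mul_one]
      _ ≤ _ := mul_le_mul (hle.trans (le_add_of_nonneg_right zero_le_one))
          (Real.rpow_le_rpow_of_exponent_le (by simp) (le_max_left _ _))
          (by positivity) (add_nonneg (tsum_nonneg hnonneg) zero_le_one)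
  · rintro ⟨t, -, M, -, h⟩
    have hsum : Summable fun i : ℕ => ((i : ℝ) + 1) ^ (-2 : ℝ) := by
      simpa using (summable_nat_add_iff 1).2
        (Real.summable_nat_rpow.2 (by norm_num : (-2 : ℝ) < -1))
    refine ⟨t + 2, Summable.of_nonneg_of_le (fun i => by positivity) (fun i => ?_)
      (hsum.mul_left M)⟩
    calc Real.exp (g i) * ((i : ℝ) + 1) ^ (-(t + 2))
        ≤ M * ((i : ℝ) + 1) ^ t * ((i : ℝ) + 1) ^ (-(t + 2)) := by gcongr; exact h i
      _ = M * ((i : ℝ) + 1) ^ (-2 : ℝ) := by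
          rw [mul_assoc, ← Real.rpow_add (hx i)]
          ring_nf

/-- Polynomial growth of `exp ∘ g` amounts to logarithmic growth of `g`. -/
theorem exists_exp_le_iff_exists_div_log_le (g : ℕ → ℝ) :
    (∃ t : ℝ, 1 < t ∧ ∃ M > (0 : ℝ), ∀ i : ℕ, Real.exp (g i) ≤ M * ((i : ℝ) + 1) ^ t) ↔
      ∃ M : ℝ, ∀ i : ℕ, 1 ≤ i → g i / Real.log ((i : ℝ) + 1) ≤ M := by
  have hx (i : ℕ) : 0 < (i : ℝ) + 1 := by positivity
  have hlog {i : ℕ} (hi : 1 ≤ i) : Real.log 2 ≤ Real.log ((i : ℝ) + 1) := by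
    have : (1 : ℝ) ≤ i := by exact_mod_cast hi
    exact Real.log_le_log two_pos (by linarith)
  have hlog2 : 0 < Real.log 2 := Real.log_pos one_lt_two
  constructor
  · rintro ⟨t, -, M, hM, h⟩
    refine ⟨|Real.log M| / Real.log 2 + t, fun i hi => ?_⟩
    rw [div_le_iff₀ (hlog2.trans_le (hlog hi)), add_mul]
    have hg : g i ≤ Real.log M + t * Real.log ((i : ℝ) + 1) := by
      rw [← Real.log_rpow (hx i), ← Real.log_mul hM.ne' (Real.rpow_pos_of_pos (hx i) t).ne']
      exact (Real.le_log_iff_exp_le (by have := hx i; positivity)).2 (h i)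
    have habs : |Real.log M| ≤ |Real.log M| / Real.log 2 * Real.log ((i : ℝ) + 1) := by
      rw [div_mul_eq_mul_div, le_div_iff₀ hlog2]
      exact mul_le_mul_of_nonneg_left (hlog hi) (abs_nonneg _)
    linarith [le_abs_self (Real.log M)]
  · rintro ⟨M, h⟩
    refine ⟨max M 2, lt_of_lt_of_le one_lt_two (le_max_right _ _), 1 + Real.exp (g 0),
      by positivity, fun i => ?_⟩
    rcases Nat.eq_zero_or_pos i with rfl | hi
    · simp
    · have hpos := hlog2.trans_le (hlog hi)
      calc Real.exp (g i) ≤ ((i : ℝ) + 1) ^ (max M 2) := by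
            rw [Real.rpow_def_of_pos (hx i), Real.exp_le_exp, mul_comm]
            exact (div_le_iff₀ hpos).1 ((h i hi).trans (le_max_left _ _))
        _ ≤ (1 + Real.exp (g 0)) * ((i : ℝ) + 1) ^ (max M 2) :=
            le_mul_of_one_le_left (by positivity) (by linarith [Real.exp_pos (g 0)])

/-- For `a_n(i) = exp(−f(α_i/n))` with `f` strictly increasing and `α_i ↑ ∞` (indices shifted
by one), and fixed `n`: `S_n(A) ≠ ∅` is equivalent to `exp(f(α_i/n)) ≤ M·i^t` for some
`t > 1, M > 0`, and to `sup_{i ≥ 2} f(α_i/n)/log(i) < ∞`. -/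
theorem stmt14 (f : ℝ → ℝ) (hf : StrictMono f) (αs : ℕ → ℝ) (hmono : StrictMono αs)
    (hpos : ∀ i, 0 < αs i) (hlim : Tendsto αs atTop atTop) (a : ℕ → ℕ → ℝ)
    (ha : ∀ n i, a n i = Real.exp (-f (αs i / ((n : ℝ) + 1)))) (n : ℕ) :
    ((∃ s : ℝ, Summable (fun i : ℕ => 1 / (((i : ℝ) + 1) ^ s * a n i))) ↔
        ∃ t : ℝ, 1 < t ∧ ∃ M > (0 : ℝ), ∀ i : ℕ,
          Real.exp (f (αs i / ((n : ℝ) + 1))) ≤ M * ((i : ℝ) + 1) ^ t) ∧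
      ((∃ t : ℝ, 1 < t ∧ ∃ M > (0 : ℝ), ∀ i : ℕ,
          Real.exp (f (αs i / ((n : ℝ) + 1))) ≤ M * ((i : ℝ) + 1) ^ t) ↔
        ∃ M : ℝ, ∀ i : ℕ, 1 ≤ i →
          f (αs i / ((n : ℝ) + 1)) / Real.log ((i : ℝ) + 1) ≤ M) := by
  simp only [ha]
  exact ⟨exists_summable_iff_exists_exp_le _, exists_exp_le_iff_exists_div_log_le _⟩
end
end

section
/- Let A be a G₁-matrix. If there exist n₀ ∈ ℕ and t ∈ ℝ with Σ_i 1/(i^t·a_{n₀}(i)) < ∞ (i.e. S_{n₀}(A) ≠ ∅), then it is not the case that for every n there exists m > n with Σ_i a_n(i)/a_m(i) < ∞; that is, the Grothendieck–Pietsch condition fails and λ₀(A) is not nuclear. -/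
open Filter Finset Topology

noncomputable section

/-- Under the Grothendieck–Pietsch condition, the rows of a decreasing matrix are summable. -/
theorem G11.summable {a : ℕ → ℕ → ℝ} (h : G11 a)
    (hN : ∀ n : ℕ, ∃ m > n, Summable (fun i => a n i / a m i)) (n : ℕ) : Summable (a n) := by
  obtain ⟨m, -, hm⟩ := hN n
  refine (hm.mul_left (a m 0)).of_nonneg_of_le (fun i => (h.pos n i).le) fun i => ?_
  have hi := h.pos m i
  rw [← mul_div_assoc, le_div_iff₀ hi, mul_comm]
  exact mul_le_mul_of_nonneg_right (h.antitone m (Nat.zero_le i)) (h.pos n i).le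

/-- A decreasing nonnegative summable sequence is `O(1 / (i + 1))`. -/
theorem exists_add_one_mul_le_of_antitone_of_summable {f : ℕ → ℝ} (h0 : ∀ i, 0 ≤ f i)
    (hf : Antitone f) (hs : Summable f) : ∃ C, ∀ i : ℕ, ((i : ℝ) + 1) * f i ≤ C := by
  refine ⟨∑' j, f j, fun i => ?_⟩
  calc ((i : ℝ) + 1) * f i = ∑ _j ∈ Finset.range (i + 1), f i := by simp
    _ ≤ ∑ j ∈ Finset.range (i + 1), f j :=
        Finset.sum_le_sum fun j hj => hf (Nat.lt_succ_iff.mp (Finset.mem_range.mp hj))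
    _ ≤ ∑' j, f j := hs.sum_le_tsum _ fun j _ => h0 j

/-- Under the Grothendieck–Pietsch condition, the rows of a `G₁`-matrix decay faster than
`(i + 1) ^ (-2 ^ k)` for every `k`. -/
theorem exists_pow_two_pow_mul_le {a : ℕ → ℕ → ℝ} (hG1 : G11 a) (hG2 : G12 a)
    (hN : ∀ n : ℕ, ∃ m > n, Summable (fun i => a n i / a m i)) (k n : ℕ) :
    ∃ C, ∀ i : ℕ, ((i : ℝ) + 1) ^ (2 ^ k) * a n i ≤ C := by
  induction k generalizing n with
  | zero =>
    simpa using exists_add_one_mul_le_of_antitone_of_summable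
      (fun i => (hG1.pos n i).le) (hG1.antitone n) (hG1.summable hN n)
  | succ k ih =>
    obtain ⟨m, -, C, hC, hm⟩ := hG2 n
    obtain ⟨D, hD⟩ := ih m
    refine ⟨C * D ^ 2, fun i => ?_⟩
    have hi := hG1.pos m i
    calc ((i : ℝ) + 1) ^ (2 ^ (k + 1)) * a n i
        ≤ ((i : ℝ) + 1) ^ (2 ^ (k + 1)) * (C * a m i ^ 2) := by gcongr; exact hm i
      _ = C * (((i : ℝ) + 1) ^ (2 ^ k) * a m i) ^ 2 := by rw [pow_succ 2 k, pow_mul]; ring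
      _ ≤ C * D ^ 2 := by gcongr; exact hD i

/-- For a `G₁`-matrix `A`, if `S_{n₀}(A) ≠ ∅` for some `n₀`, then `λ₀(A)` fails the
Grothendieck–Pietsch condition, i.e. it is not nuclear. -/
theorem stmt15 (a : ℕ → ℕ → ℝ) (hK : KotheMatrix a) (hG1 : G11 a) (hG2 : G12 a)
    (h : ∃ n₀ : ℕ, ∃ t : ℝ, Summable (fun i : ℕ => 1 / (((i : ℝ) + 1) ^ t * a n₀ i))) :
    ¬ ∀ n : ℕ, ∃ m > n, Summable (fun i => a n i / a m i) := by
  intro hN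
  obtain ⟨n, t, hs⟩ := h
  obtain ⟨k, hk⟩ := exists_nat_ge t
  have htk : t ≤ ((2 ^ k : ℕ) : ℝ) :=
    hk.trans (by exact_mod_cast Nat.lt_two_pow_self.le)
  obtain ⟨C, hC⟩ := exists_pow_two_pow_mul_le hG1 hG2 hN k n
  have hCpos : 0 < C := lt_of_lt_of_le (by have := hG1.pos n 0; positivity) (hC 0)
  have hle : ∀ i : ℕ, 1 / C ≤ 1 / (((i : ℝ) + 1) ^ t * a n i) := fun i => by
    have hi := hG1.pos n i
    refine one_div_le_one_div_of_le (by positivity) (le_trans ?_ (hC i))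
    rw [← Real.rpow_natCast]
    gcongr
    linarith [(Nat.cast_nonneg i : (0 : ℝ) ≤ i)]
  have h0 : 1 / C ≤ 0 := ge_of_tendsto' hs.tendsto_atTop_zero hle
  exact absurd h0 (not_le.mpr (by positivity))
end
end

section
/- Let A be a G₁-matrix with lim_{i→∞} a_n(i) = 0 for every n. If there exist n₀ ∈ ℕ and t ∈ ℝ with Σ_i 1/(i^t·a_{n₀}(i)) < ∞ (i.e. S_{n₀}(A) ≠ ∅), then inf { s ∈ ℝ : there exists n ∈ ℕ with Σ_i 1/(i^s·a_n(i)) < ∞ } = 1; that is, s_0(A) := inf_n (inf S_n(A)) = 1. -/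
open Filter Finset Topology

noncomputable section

theorem G11.le_zero {a : ℕ → ℕ → ℝ} (h : G11 a) (n i : ℕ) : a n i ≤ a n 0 :=
  antitone_nat_of_succ_le (fun i => (h n i).2) (Nat.zero_le i)

theorem summable_one_div_nat_add_one_rpow {s : ℝ} :
    Summable (fun i : ℕ => 1 / ((i : ℝ) + 1) ^ s) ↔ 1 < s := by
  rw [← Real.summable_one_div_nat_rpow,
    ← summable_nat_add_iff (f := fun i : ℕ => 1 / (i : ℝ) ^ s) 1]
  simp only [Nat.cast_add, Nat.cast_one]

/-- If the entries of a row are bounded above, the corresponding exponents exceed one. -/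
theorem G11.one_lt_of_summable {a : ℕ → ℕ → ℝ} (h : G11 a) {n : ℕ} {s : ℝ}
    (hs : Summable (fun i : ℕ => 1 / (((i : ℝ) + 1) ^ s * a n i))) : 1 < s := by
  refine summable_one_div_nat_add_one_rpow.1 ?_
  refine Summable.of_nonneg_of_le (fun i => by positivity) (fun i => ?_) (hs.mul_left (a n 0))
  have hi := h.pos n i
  have hp : 0 < ((i : ℝ) + 1) ^ s := by positivity
  rw [mul_one_div, div_le_div_iff₀ hp (by positivity)]
  nlinarith [mul_le_mul_of_nonneg_right (h.le_zero n i) hp.le]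

/-- Under (G1-2), a polynomial lower bound on a row improves to one with half the exponent. -/
theorem G12.exists_rpow_le_half {a : ℕ → ℕ → ℝ} (hpos : ∀ n i, 0 < a n i) (h : G12 a)
    {t : ℝ} (ht : ∃ n, ∃ c > 0, ∀ i : ℕ, c * ((i : ℝ) + 1) ^ (-t) ≤ a n i) :
    ∃ n, ∃ c > 0, ∀ i : ℕ, c * ((i : ℝ) + 1) ^ (-(t / 2)) ≤ a n i := by
  obtain ⟨n, c, hc, hn⟩ := ht
  obtain ⟨m, -, C, hC, hm⟩ := h n
  refine ⟨m, √(c / C), Real.sqrt_pos.2 (div_pos hc hC), fun i => ?_⟩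
  refine le_of_sq_le_sq ?_ (hpos m i).le
  have hsq : (((i : ℝ) + 1) ^ (-(t / 2))) ^ 2 = ((i : ℝ) + 1) ^ (-t) := by
    rw [← Real.rpow_mul_natCast (by positivity)]
    congr 1
    push_cast
    ring
  rw [mul_pow, hsq, Real.sq_sqrt (div_pos hc hC).le, div_mul_eq_mul_div, div_le_iff₀ hC,
    mul_comm (a m i ^ 2)]
  exact (hn i).trans (hm i)

theorem G12.exists_rpow_le_div_two_pow {a : ℕ → ℕ → ℝ} (hpos : ∀ n i, 0 < a n i) (h : G12 a)
    {t : ℝ} (ht : ∃ n, ∃ c > 0, ∀ i : ℕ, c * ((i : ℝ) + 1) ^ (-t) ≤ a n i) (k : ℕ) :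
    ∃ n, ∃ c > 0, ∀ i : ℕ, c * ((i : ℝ) + 1) ^ (-(t / 2 ^ k)) ≤ a n i := by
  induction k with
  | zero => simpa using ht
  | succ k ih =>
    have := h.exists_rpow_le_half hpos ih
    rwa [div_div, ← pow_succ] at this

/-- Summability against a row yields a polynomial lower bound on that row. -/
theorem exists_rpow_le_of_summable {b : ℕ → ℝ} (hpos : ∀ i, 0 < b i) {t : ℝ}
    (hs : Summable (fun i : ℕ => 1 / (((i : ℝ) + 1) ^ t * b i))) :
    ∃ c > 0, ∀ i : ℕ, c * ((i : ℝ) + 1) ^ (-t) ≤ b i := by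
  have hterm : ∀ i : ℕ, 0 < 1 / (((i : ℝ) + 1) ^ t * b i) := fun i => by
    have := hpos i
    positivity
  have hK : 0 < ∑' i : ℕ, 1 / (((i : ℝ) + 1) ^ t * b i) :=
    hs.tsum_pos (fun i => (hterm i).le) 0 (hterm 0)
  refine ⟨_, inv_pos.2 hK, fun i => ?_⟩
  have hle := hs.le_tsum i fun j _ => (hterm j).le
  have hp : 0 < ((i : ℝ) + 1) ^ t := by positivity
  rw [div_le_iff₀ (mul_pos hp (hpos i))] at hle
  rw [Real.rpow_neg (by positivity), ← mul_inv, ← one_div, div_le_iff₀ (mul_pos hK hp)]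
  linarith

/-- A polynomial lower bound on a row makes every exponent exceeding it by more than one
admissible. -/
theorem summable_of_rpow_le {b : ℕ → ℝ} (hpos : ∀ i, 0 < b i) {c r s : ℝ} (hc : 0 < c)
    (hb : ∀ i : ℕ, c * ((i : ℝ) + 1) ^ (-r) ≤ b i) (hrs : 1 < s - r) :
    Summable (fun i : ℕ => 1 / (((i : ℝ) + 1) ^ s * b i)) := by
  refine Summable.of_nonneg_of_le (fun i => ?_) (fun i => ?_)
    ((summable_one_div_nat_add_one_rpow.2 hrs).mul_left c⁻¹)
  · have := hpos i
    positivity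
  · have hp : (0 : ℝ) < (i : ℝ) + 1 := by positivity
    rw [← one_div c, one_div_mul_one_div, sub_eq_add_neg, Real.rpow_add hp, mul_left_comm]
    gcongr
    exact hb i

/-- For a `G₁`-matrix with vanishing rows, if some `S_{n₀}(A)` is nonempty then
`s₀(A) = inf_n inf S_n(A) = 1`. -/
theorem stmt17 (a : ℕ → ℕ → ℝ) (hK : KotheMatrix a) (hG1 : G11 a) (hG2 : G12 a)
    (hvanish : ∀ n, Tendsto (fun i => a n i) atTop (𝓝 0))
    (h : ∃ n₀ : ℕ, ∃ t : ℝ, Summable (fun i : ℕ => 1 / (((i : ℝ) + 1) ^ t * a n₀ i))) :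
    sInf {s : ℝ | ∃ n : ℕ, Summable (fun i : ℕ => 1 / (((i : ℝ) + 1) ^ s * a n i))} = 1 := by
  obtain ⟨n₀, t, ht⟩ := h
  have hlow := hG2.exists_rpow_le_div_two_pow hG1.pos
    ⟨n₀, exists_rpow_le_of_summable (hG1.pos n₀) ht⟩
  refine csInf_eq_of_forall_ge_of_forall_gt_exists_lt ⟨t, n₀, ht⟩ ?_ ?_
  · rintro s ⟨n, hs⟩
    exact (hG1.one_lt_of_summable hs).le
  · intro w hw
    have hlim : Tendsto (fun k : ℕ => t / 2 ^ k) atTop (𝓝 0) :=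
      tendsto_const_nhds.div_atTop (tendsto_pow_atTop_atTop_of_one_lt one_lt_two)
    obtain ⟨k, hk⟩ := (hlim.eventually_lt_const (show (0 : ℝ) < (w - 1) / 2 by linarith)).exists
    obtain ⟨n, c, hc, hn⟩ := hlow k
    exact ⟨(w + 1) / 2, ⟨n, summable_of_rpow_le (hG1.pos n) hc hn (by linarith)⟩, by linarith⟩
end
end

section
/- Let A be a G₁-matrix with lim_{i→∞} a_n(i) = 0 for every n. Then: (a) for every k, n ∈ ℕ and every x ∈ λ₀(A), p_n(C^k x) ≤ p_n(x), where C^k denotes the k-th iterate of the Cesàro operator (so C is power bounded on λ₀(A)); (b) an element x ∈ λ₀(A) satisfies C x = x if and only if x is a constant sequence, i.e. ker(I − C) = span{(1,1,1,…)}; (c) for every x ∈ λ₀(A) and every n, lim_{k→∞} p_n( (1/k)·Σ_{j=1}^{k} C^j x − x_1·𝟙 ) = 0, where 𝟙 = (1,1,1,…); i.e. the Cesàro means of C converge in λ₀(A) to the projection x ↦ x_1·𝟙. -/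
open Filter Finset Topology

noncomputable section

theorem cesaro_sub (x y : ℕ → ℂ) : cesaro (x - y) = cesaro x - cesaro y := by
  funext i
  simp [cesaro, Finset.sum_sub_distrib, sub_div]

theorem cesaro_iterate_sub (k : ℕ) (x y : ℕ → ℂ) :
    cesaro^[k] (x - y) = cesaro^[k] x - cesaro^[k] y := by
  induction k generalizing x y with
  | zero => rfl
  | succ k ih => rw [Function.iterate_succ_apply, cesaro_sub, ih]; rfl

theorem cesaro_const (c : ℂ) : cesaro (fun _ => c) = fun _ => c := by
  funext i
  have h : (i : ℂ) + 1 ≠ 0 := Nat.cast_add_one_ne_zero i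
  simp only [cesaro, Finset.sum_const, Finset.card_range, nsmul_eq_mul]
  push_cast
  field_simp

theorem cesaro_apply_zero (x : ℕ → ℂ) : cesaro x 0 = x 0 := by
  simp [cesaro]

theorem cesaro_iterate_apply_zero (k : ℕ) (x : ℕ → ℂ) : cesaro^[k] x 0 = x 0 := by
  induction k with
  | zero => rfl
  | succ k ih => rw [Function.iterate_succ_apply', cesaro_apply_zero, ih]

/-- The Cesàro operator is a contraction for the sup norm with an antitone weight. -/
theorem weighted_norm_cesaro_le {w : ℕ → ℝ} (hw : Antitone w) (hw0 : ∀ i, 0 ≤ w i) {M : ℝ}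
    {x : ℕ → ℂ} (hx : ∀ i, w i * ‖x i‖ ≤ M) (i : ℕ) : w i * ‖cesaro x i‖ ≤ M := by
  have hi : (0 : ℝ) < (i : ℝ) + 1 := by positivity
  calc w i * ‖cesaro x i‖
      ≤ w i * ((∑ j ∈ Finset.range (i + 1), ‖x j‖) / ((i : ℝ) + 1)) :=
        mul_le_mul_of_nonneg_left (norm_cesaro_le x i) (hw0 i)
    _ = (∑ j ∈ Finset.range (i + 1), w i * ‖x j‖) / ((i : ℝ) + 1) := by
        rw [← Finset.mul_sum, mul_div_assoc]
    _ ≤ M := by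
        rw [div_le_iff₀ hi]
        have h := Finset.sum_le_card_nsmul (Finset.range (i + 1)) (fun j => w i * ‖x j‖) M
          fun j hj => (mul_le_mul_of_nonneg_right
            (hw (Nat.lt_succ_iff.mp (Finset.mem_range.mp hj))) (norm_nonneg _)).trans (hx j)
        rw [Finset.card_range, nsmul_eq_mul] at h
        push_cast at h
        linarith

theorem weighted_norm_cesaro_iterate_le {w : ℕ → ℝ} (hw : Antitone w) (hw0 : ∀ i, 0 ≤ w i)
    {M : ℝ} {x : ℕ → ℂ} (hx : ∀ i, w i * ‖x i‖ ≤ M) (k i : ℕ) :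
    w i * ‖cesaro^[k] x i‖ ≤ M := by
  induction k generalizing i with
  | zero => exact hx i
  | succ k ih =>
    rw [Function.iterate_succ_apply']
    exact weighted_norm_cesaro_le hw hw0 ih i

/-- On the first `N + 1` coordinates of a sequence vanishing at `0`, the Cesàro operator
contracts the sup norm by the factor `N / (N + 1)`. -/
theorem norm_cesaro_le_of_apply_zero {x : ℕ → ℂ} (hx0 : x 0 = 0) {N : ℕ} {M : ℝ}
    (hx : ∀ i ≤ N, ‖x i‖ ≤ M) {i : ℕ} (hi : i ≤ N) :
    ‖cesaro x i‖ ≤ M * (N / ((N : ℝ) + 1)) := by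
  have hM : 0 ≤ M := (norm_nonneg _).trans (hx i hi)
  have h := Finset.sum_le_card_nsmul (Finset.range i) (fun j => ‖x (j + 1)‖) M
    fun j hj => hx (j + 1) (by have := Finset.mem_range.mp hj; omega)
  rw [Finset.card_range, nsmul_eq_mul] at h
  have hiN : (i : ℝ) ≤ N := by exact_mod_cast hi
  calc ‖cesaro x i‖ ≤ (∑ j ∈ Finset.range (i + 1), ‖x j‖) / ((i : ℝ) + 1) := norm_cesaro_le x i
    _ ≤ (i * M) / ((i : ℝ) + 1) := by
        rw [Finset.sum_range_succ', hx0, norm_zero, add_zero]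
        gcongr
    _ = M * (i / ((i : ℝ) + 1)) := by ring
    _ ≤ M * (N / ((N : ℝ) + 1)) := by
        refine mul_le_mul_of_nonneg_left ?_ hM
        rw [div_le_div_iff₀ (by positivity) (by positivity)]
        linarith

theorem norm_cesaro_iterate_le_of_apply_zero {x : ℕ → ℂ} (hx0 : x 0 = 0) {N : ℕ} {M : ℝ}
    (hx : ∀ i ≤ N, ‖x i‖ ≤ M) (k : ℕ) {i : ℕ} (hi : i ≤ N) :
    ‖cesaro^[k] x i‖ ≤ M * (N / ((N : ℝ) + 1)) ^ k := by
  induction k generalizing i with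
  | zero => simpa using hx i hi
  | succ k ih =>
    rw [Function.iterate_succ_apply', pow_succ, ← mul_assoc]
    exact norm_cesaro_le_of_apply_zero (by rw [cesaro_iterate_apply_zero, hx0])
      (fun j hj => ih hj) hi

/-- Bounded sequences vanishing at `0` have Cesàro iterates tending to `0` in every weighted
sup norm with antitone weight vanishing at infinity. -/
theorem eventually_weighted_norm_cesaro_iterate_le_of_bounded {w : ℕ → ℝ} (hw : Antitone w)
    (hw0 : ∀ i, 0 ≤ w i) (hlim : Tendsto w atTop (𝓝 0)) {x : ℕ → ℂ} (hx0 : x 0 = 0) {B : ℝ}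
    (hB : ∀ i, ‖x i‖ ≤ B) {ε : ℝ} (hε : 0 < ε) :
    ∀ᶠ k in atTop, ∀ i, w i * ‖cesaro^[k] x i‖ ≤ ε := by
  have hbd : ∀ k i, ‖cesaro^[k] x i‖ ≤ B := fun k i => by
    have := weighted_norm_cesaro_iterate_le (w := fun _ => 1) antitone_const
      (fun _ => zero_le_one) (x := x) (M := B) (by simpa using hB) k i
    simpa using this
  have htail : Tendsto (fun i => w i * B) atTop (𝓝 0) := by simpa using hlim.mul_const B
  obtain ⟨N, hN⟩ := eventually_atTop.mp (htail.eventually_le_const hε)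
  have hq : Tendsto (fun k : ℕ => w 0 * (B * ((N : ℝ) / ((N : ℝ) + 1)) ^ k)) atTop (𝓝 0) := by
    have h := tendsto_pow_atTop_nhds_zero_of_lt_one (r := (N : ℝ) / ((N : ℝ) + 1))
      (by positivity) ((div_lt_one (by positivity)).mpr (lt_add_one _))
    simpa using (h.const_mul B).const_mul (w 0)
  filter_upwards [hq.eventually_le_const hε] with k hk i
  rcases le_total i N with hi | hi
  · refine le_trans ?_ hk
    exact mul_le_mul (hw (Nat.zero_le i))
      (norm_cesaro_iterate_le_of_apply_zero hx0 (fun j _ => hB j) k hi) (norm_nonneg _) (hw0 0)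
  · exact (mul_le_mul_of_nonneg_left (hbd k i) (hw0 i)).trans (hN i hi)

theorem eventually_weighted_norm_cesaro_iterate_le {w : ℕ → ℝ} (hw : Antitone w)
    (hw0 : ∀ i, 0 ≤ w i) (hlim : Tendsto w atTop (𝓝 0)) {x : ℕ → ℂ} (hx0 : x 0 = 0)
    (hx : Tendsto (fun i => w i * ‖x i‖) atTop (𝓝 0)) {ε : ℝ} (hε : 0 < ε) :
    ∀ᶠ k in atTop, ∀ i, w i * ‖cesaro^[k] x i‖ ≤ ε := by
  obtain ⟨m, hm⟩ := eventually_atTop.mp (hx.eventually_le_const (half_pos hε))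
  let z : ℕ → ℂ := fun i => if i < m then x i else 0
  have hz0 : z 0 = 0 := by simp [z, hx0]
  have hzB : ∀ i, ‖z i‖ ≤ ∑ j ∈ Finset.range m, ‖x j‖ := fun i => by
    by_cases hi : i < m
    · simpa [z, hi] using Finset.single_le_sum (f := fun j => ‖x j‖)
        (fun j _ => norm_nonneg _) (Finset.mem_range.mpr hi)
    · simpa [z, hi] using Finset.sum_nonneg (s := Finset.range m) fun j _ => norm_nonneg (x j)
  have htail : ∀ i, w i * ‖(x - z) i‖ ≤ ε / 2 := fun i => by
    by_cases hi : i < m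
    · simpa [z, hi] using (half_pos hε).le
    · simpa [z, hi] using hm i (not_lt.mp hi)
  filter_upwards [eventually_weighted_norm_cesaro_iterate_le_of_bounded hw hw0 hlim hz0 hzB
    (half_pos hε)] with k hk i
  have h := weighted_norm_cesaro_iterate_le hw hw0 htail k i
  have hsplit : cesaro^[k] x i = cesaro^[k] (x - z) i + cesaro^[k] z i := by
    simp [cesaro_iterate_sub]
  calc w i * ‖cesaro^[k] x i‖
      ≤ w i * (‖cesaro^[k] (x - z) i‖ + ‖cesaro^[k] z i‖) := by
        rw [hsplit]
        exact mul_le_mul_of_nonneg_left (norm_add_le _ _) (hw0 i)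
    _ ≤ ε := by linarith [hk i]

theorem eq_apply_zero_of_cesaro_eq {x : ℕ → ℂ} (hx : ∀ i, cesaro x i = x i) (i : ℕ) :
    x i = x 0 := by
  induction i using Nat.strong_induction_on with
  | _ i ih =>
    rcases i.eq_zero_or_pos with rfl | hi
    · rfl
    have h := hx i
    have hi1 : (i : ℂ) + 1 ≠ 0 := Nat.cast_add_one_ne_zero i
    rw [cesaro, div_eq_iff hi1, Finset.sum_range_succ,
      Finset.sum_congr rfl fun j hj => ih j (Finset.mem_range.mp hj), Finset.sum_const,
      Finset.card_range, nsmul_eq_mul] at h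
    have hi0 : (i : ℂ) ≠ 0 := Nat.cast_ne_zero.mpr hi.ne'
    exact mul_left_cancel₀ hi0 (by linear_combination -h)

theorem cesaro_iterate_sub_const (k : ℕ) (x : ℕ → ℂ) (c : ℂ) (i : ℕ) :
    cesaro^[k] (x - fun _ => c) i = cesaro^[k] x i - c := by
  rw [cesaro_iterate_sub, Function.iterate_fixed (cesaro_const c)]
  rfl

theorem tendsto_pnorm_cesaro_iterate {a : ℕ → ℕ → ℝ} {n : ℕ} (hw : Antitone (a n))
    (hw0 : ∀ i, 0 ≤ a n i) (hlim : Tendsto (a n) atTop (𝓝 0)) {x : ℕ → ℂ} (hx0 : x 0 = 0)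
    (hx : Tendsto (fun i => a n i * ‖x i‖) atTop (𝓝 0)) :
    Tendsto (fun k => pnorm a n (cesaro^[k] x)) atTop (𝓝 0) := by
  have hnonneg : ∀ k, 0 ≤ pnorm a n (cesaro^[k] x) := fun k =>
    Real.iSup_nonneg fun i => mul_nonneg (hw0 i) (norm_nonneg _)
  refine tendsto_order.mpr ⟨fun b hb => Eventually.of_forall fun k => hb.trans_le (hnonneg k),
    fun b hb => ?_⟩
  filter_upwards [eventually_weighted_norm_cesaro_iterate_le hw hw0 hlim hx0 hx (half_pos hb)]
    with k hk
  exact (ciSup_le hk).trans_lt (half_lt_self hb)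

/-- For a `G₁`-space `λ₀(A)` (with vanishing rows): (a) `C` is power bounded,
`p_n(C^k x) ≤ p_n(x)`; (b) `ker(I − C)` consists exactly of the constant sequences;
(c) the Cesàro means `(1/k) Σ_{j=1}^k C^j x` converge in `λ₀(A)` to `x_1·𝟙`. -/
theorem stmt19 (a : ℕ → ℕ → ℝ) (hK : KotheMatrix a) (hG1 : G11 a) (hG2 : G12 a)
    (hvanish : ∀ n, Tendsto (fun i => a n i) atTop (𝓝 0)) :
    (∀ k n : ℕ, ∀ x : ℕ → ℂ, inLambda0 a x → pnorm a n (cesaro^[k] x) ≤ pnorm a n x) ∧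
      (∀ x : ℕ → ℂ, inLambda0 a x →
        ((∀ i, cesaro x i = x i) ↔ ∃ c : ℂ, ∀ i, x i = c)) ∧
      (∀ x : ℕ → ℂ, inLambda0 a x → ∀ n : ℕ,
        Tendsto (fun k : ℕ => pnorm a n
            (fun i => (1 / (k : ℂ)) * (∑ j ∈ Finset.range k, cesaro^[j + 1] x i) - x 0))
          atTop (𝓝 0)) := by
  have hanti : ∀ n, Antitone (a n) := fun n => antitone_nat_of_succ_le fun i => (hG1 n i).2
  have hnonneg : ∀ n i, 0 ≤ a n i := fun n i => (hK.1 n i).1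
  have hle : ∀ n, ∀ x : ℕ → ℂ, inLambda0 a x → ∀ i, a n i * ‖x i‖ ≤ pnorm a n x :=
    fun n x hx => le_ciSup (hx n).bddAbove_range
  refine ⟨fun k n x hx => ?_, fun x _ => ⟨fun h => ⟨x 0, eq_apply_zero_of_cesaro_eq h⟩, ?_⟩,
    fun x hx n => ?_⟩
  · exact ciSup_le (weighted_norm_cesaro_iterate_le (hanti n) (hnonneg n) (hle n x hx) k)
  · rintro ⟨c, hc⟩ i
    obtain rfl : x = fun _ => c := funext hc
    rw [cesaro_const]
  · set y : ℕ → ℂ := x - fun _ => x 0 with hy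
    have hy0 : y 0 = 0 := by simp [hy]
    have hyL : inLambda0 a y := fun m => by
      refine squeeze_zero (fun i => mul_nonneg (hnonneg m i) (norm_nonneg _))
        (g := fun i => a m i * ‖x i‖ + a m i * ‖x 0‖) (fun i => ?_) ?_
      · rw [← mul_add]
        exact mul_le_mul_of_nonneg_left (norm_sub_le _ _) (hnonneg m i)
      · simpa using (hx m).add ((hvanish m).mul_const ‖x 0‖)
    have hlek : ∀ k i, a n i * ‖cesaro^[k] y i‖ ≤ pnorm a n (cesaro^[k] y) := fun k =>
      le_ciSup (f := fun i => a n i * ‖cesaro^[k] y i‖) ⟨pnorm a n y, by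
        rintro _ ⟨i, rfl⟩
        exact weighted_norm_cesaro_iterate_le (hanti n) (hnonneg n) (hle n y hyL) k i⟩
    have hlim := ((tendsto_add_atTop_iff_nat 1).mpr (tendsto_pnorm_cesaro_iterate (hanti n)
      (hnonneg n) (hvanish n) hy0 (hyL n))).cesaro
    refine squeeze_zero' (Eventually.of_forall fun k =>
      Real.iSup_nonneg fun i => mul_nonneg (hnonneg n i) (norm_nonneg _)) ?_ hlim
    filter_upwards [eventually_gt_atTop 0] with k hk
    refine ciSup_le fun i => ?_
    have hk0 : (k : ℂ) ≠ 0 := Nat.cast_ne_zero.mpr hk.ne'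
    have hmean : (1 / (k : ℂ)) * (∑ j ∈ Finset.range k, cesaro^[j + 1] x i) - x 0
        = (k : ℂ)⁻¹ * ∑ j ∈ Finset.range k, cesaro^[j + 1] y i := by
      simp only [hy, cesaro_iterate_sub_const, Finset.sum_sub_distrib, Finset.sum_const,
        Finset.card_range, nsmul_eq_mul]
      field_simp
    beta_reduce
    rw [hmean, norm_mul, norm_inv, Complex.norm_natCast]
    calc a n i * ((k : ℝ)⁻¹ * ‖∑ j ∈ Finset.range k, cesaro^[j + 1] y i‖)
        = (k : ℝ)⁻¹ * (a n i * ‖∑ j ∈ Finset.range k, cesaro^[j + 1] y i‖) := by ring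
      _ ≤ (k : ℝ)⁻¹ * (a n i * ∑ j ∈ Finset.range k, ‖cesaro^[j + 1] y i‖) := by
          have := hnonneg n i
          gcongr
          exact norm_sum_le _ _
      _ ≤ (k : ℝ)⁻¹ * ∑ j ∈ Finset.range k, pnorm a n (cesaro^[j + 1] y) := by
          rw [Finset.mul_sum]
          gcongr with j
          exact hlek (j + 1) i
end
end
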